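/- arXiv:1605.02584 — 2 statements merged into one kernel-verified Lean document; each statement's English description precedes it below -/
import Mathlib

section
/- Let c > 0, Q_c(x) = (3c/2)·cosh^{-2}(√c·x/2), and ℒ_c u = −u'' + c·u − 2·Q_c·u. Then for every smooth compactly supported function w : ℝ → ℝ: ∫_ℝ w(x)·((ℒ_c + 5c/4)w)(x) dx ≥ (5c/4)·( ∫_ℝ w(x)² dx − (∫_ℝ Q_c(x)³ dx)^{-1}·(∫_ℝ w(x)·Q_c(x)^{3/2} dx)² ). -/
open MeasureTheory

/-- The spectral gap on a bounded interval, for a function `w` vanishing at the endpoints. Here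
`q` plays the role of the ground state and `T` that of `x ↦ tanh (k x)`. With `v` the solution of
`-v' + 3 k T v = w - a q` vanishing at both endpoints, the difference of the integrands is a sum of
squares plus an exact derivative. -/
theorem spectral_gap_interval {k R : ℝ} {T q w : ℝ → ℝ} (hR : 0 < R)
    (hT : ∀ x, HasDerivAt T (k * (1 - T x ^ 2)) x) (hq : ∀ x, 0 < q x)
    (hq' : ∀ x, HasDerivAt q (-3 * k * T x * q x) x) (hw : ContDiff ℝ 2 w)
    (hwl : w (-R) = 0) (hwr : w R = 0) :
    5 * k ^ 2 * ((∫ x in (-R)..R, w x ^ 2)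
        - (∫ x in (-R)..R, q x ^ 2)⁻¹ * (∫ x in (-R)..R, w x * q x) ^ 2)
      ≤ ∫ x in (-R)..R,
          w x * (-(deriv (deriv w) x) + 9 * k ^ 2 * w x - 12 * k ^ 2 * (1 - T x ^ 2) * w x) := by
  have cT : Continuous T := continuous_iff_continuousAt.2 fun x => (hT x).continuousAt
  have cq : Continuous q := continuous_iff_continuousAt.2 fun x => (hq' x).continuousAt
  have cw : Continuous w := hw.continuous
  have hdw : ContDiff ℝ 1 (deriv w) :=
    ContDiff.deriv' (n := 1) (by rwa [one_add_one_eq_two])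
  have cdw : Continuous (deriv w) := hdw.continuous
  have cddw : Continuous (deriv (deriv w)) := hdw.continuous_deriv le_rfl
  have dw : ∀ x, HasDerivAt w (deriv w x) x := fun x =>
    (hw.differentiable (by norm_num) x).hasDerivAt
  have ddw : ∀ x, HasDerivAt (deriv w) (deriv (deriv w) x) x := fun x =>
    (hdw.differentiable (by norm_num) x).hasDerivAt
  set I := ∫ x in (-R)..R, q x ^ 2 with hI
  set J := ∫ x in (-R)..R, w x * q x with hJ
  have hIpos : 0 < I := intervalIntegral.intervalIntegral_pos_of_pos
    ((cq.pow 2).intervalIntegrable _ _) (fun x => pow_pos (hq x) 2) (by linarith)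
  set a := I⁻¹ * J with ha
  set F : ℝ → ℝ := fun x => ∫ t in (-R)..x, (w t - a * q t) * q t with hF
  have cu : Continuous fun t => (w t - a * q t) * q t := by fun_prop
  have dF : ∀ x, HasDerivAt F ((w x - a * q x) * q x) x := fun x =>
    intervalIntegral.integral_hasDerivAt_right (cu.intervalIntegrable _ _)
      (cu.stronglyMeasurableAtFilter _ _) cu.continuousAt
  have cF : Continuous F := continuous_iff_continuousAt.2 fun x => (dF x).continuousAt
  have hFl : F (-R) = 0 := by simp [hF]
  have hFr : F R = 0 := by
    have h : F R = J - a * I := by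
      rw [hF, hJ, hI, ← intervalIntegral.integral_const_mul,
        ← intervalIntegral.integral_sub ((by fun_prop : Continuous _).intervalIntegrable _ _)
          ((by fun_prop : Continuous _).intervalIntegrable _ _)]
      exact intervalIntegral.integral_congr fun x _ => by ring
    rw [h, ha]
    field_simp
    ring
  set v : ℝ → ℝ := fun x => -(F x / q x) with hv
  have cv : Continuous v := (cF.div cq fun x => (hq x).ne').neg
  have dv : ∀ x, HasDerivAt v (3 * k * T x * v x - (w x - a * q x)) x := fun x => by
    refine (((dF x).div (hq' x) (hq x).ne').neg).congr_deriv ?_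
    have := (hq x).ne'
    simp only [hv]
    field_simp
    ring
  have hvl : v (-R) = 0 := by simp [hv, hFl]
  have hvr : v R = 0 := by simp [hv, hFr]
  set f : ℝ → ℝ := fun x => w x *
    (-(deriv (deriv w) x) + 9 * k ^ 2 * w x - 12 * k ^ 2 * (1 - T x ^ 2) * w x) with hf
  set g : ℝ → ℝ := fun x => 5 * k ^ 2 * (w x ^ 2 - a * (w x * q x)) with hg
  set S : ℝ → ℝ := fun x => (deriv w x + 3 * k * T x * w x - 5 * k ^ 2 * v x) ^ 2
    + 5 * k ^ 2 * (5 * k * T x * v x - (w x - a * q x)) ^ 2 with hS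
  have cf : Continuous f := by fun_prop
  have cg : Continuous g := by fun_prop
  have cS : Continuous S := by fun_prop
  have dG : ∀ x, HasDerivAt (fun x => -(w x * deriv w x) - 3 * k * (T x * w x ^ 2)
      + 10 * k ^ 2 * (v x * w x) + 5 * k ^ 2 * a * F x - 25 * k ^ 3 * (T x * v x ^ 2))
      (f x - g x - S x) x := fun x => by
    refine (((((((dw x).mul (ddw x)).neg.sub (((hT x).mul ((dw x).pow 2)).const_mul (3 * k))).add
      (((dv x).mul (dw x)).const_mul (10 * k ^ 2))).add ((dF x).const_mul (5 * k ^ 2 * a))).sub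
      (((hT x).mul ((dv x).pow 2)).const_mul (25 * k ^ 3)))).congr_deriv ?_
    simp only [hf, hg, hS, Pi.pow_apply]
    push_cast
    ring
  have hint : ∫ x in (-R)..R, (f x - g x - S x) = 0 := by
    rw [intervalIntegral.integral_eq_sub_of_hasDerivAt (fun x _ => dG x)
      (((cf.sub cg).sub cS).intervalIntegrable _ _)]
    simp [hwl, hwr, hvl, hvr, hFl, hFr]
  rw [intervalIntegral.integral_sub ((cf.fun_sub cg).intervalIntegrable _ _)
      (cS.intervalIntegrable _ _), intervalIntegral.integral_sub (cf.intervalIntegrable _ _)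
      (cg.intervalIntegrable _ _)] at hint
  have hSnn : 0 ≤ ∫ x in (-R)..R, S x :=
    intervalIntegral.integral_nonneg (by linarith) fun x _ => by positivity
  have hgint : ∫ x in (-R)..R, g x
      = 5 * k ^ 2 * ((∫ x in (-R)..R, w x ^ 2) - I⁻¹ * J ^ 2) := by
    rw [hg, intervalIntegral.integral_const_mul,
      intervalIntegral.integral_sub ((by fun_prop : Continuous _).intervalIntegrable _ _)
        ((by fun_prop : Continuous _).intervalIntegrable _ _),
      intervalIntegral.integral_const_mul, ← hJ, ha]
    ring
  linarith

/-- Powers of the hyperbolic secant with exponent at least two are integrable. -/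
theorem integrable_inv_cosh_pow {k : ℝ} (hk : k ≠ 0) {n : ℕ} (hn : 2 ≤ n) :
    Integrable fun x : ℝ => (Real.cosh (k * x))⁻¹ ^ n := by
  have hcont : Continuous fun x : ℝ => (Real.cosh (k * x))⁻¹ ^ n :=
    ((Real.continuous_cosh.comp (continuous_const.mul continuous_id)).inv₀
      fun x => (Real.cosh_pos _).ne').pow n
  refine (integrable_inv_one_add_sq.comp_mul_left' hk).mono' hcont.aestronglyMeasurable
    (Filter.Eventually.of_forall fun x => ?_)
  have h1 := Real.one_le_cosh (k * x)
  have h0 : 0 ≤ (Real.cosh (k * x))⁻¹ := by positivity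
  rw [Real.norm_of_nonneg (by positivity)]
  refine (pow_le_pow_of_le_one h0 (inv_le_one_of_one_le₀ h1) hn).trans ?_
  rw [inv_pow]
  refine inv_anti₀ (by positivity) ?_
  rw [Real.cosh_sq', ← sq_abs (k * x), ← sq_abs (Real.sinh _), Real.abs_sinh]
  gcongr
  exact Real.self_le_sinh_iff.2 (abs_nonneg _)

theorem spectral_gap_inequality
    (c : ℝ) (hc : 0 < c) (Q : ℝ → ℝ)
    (hQ : ∀ x, Q x = (3 * c / 2) * (Real.cosh (Real.sqrt c * x / 2))⁻¹ ^ 2) :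
    ∀ w : ℝ → ℝ, ContDiff ℝ (⊤ : ℕ∞) w → HasCompactSupport w →
      ∫ x : ℝ, w x *
          (-(deriv (deriv w) x) + c * w x - 2 * Q x * w x + (5 * c / 4) * w x)
        ≥ (5 * c / 4) *
            ((∫ x : ℝ, (w x) ^ 2)
              - (∫ x : ℝ, (Q x) ^ 3)⁻¹ *
                  (∫ x : ℝ, w x * (Q x) ^ ((3 : ℝ) / 2)) ^ 2) := by
  intro w hw hsupp
  obtain ⟨k, hk, rfl⟩ : ∃ k : ℝ, 0 < k ∧ c = 4 * k ^ 2 :=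
    ⟨√c / 2, by positivity, by rw [div_pow, Real.sq_sqrt hc.le]; ring⟩
  have hsqrt : √(4 * k ^ 2) = 2 * k := by
    rw [show 4 * k ^ 2 = (2 * k) ^ 2 by ring, Real.sqrt_sq (by positivity)]
  replace hQ : ∀ x, Q x = 6 * k ^ 2 * (Real.cosh (k * x))⁻¹ ^ 2 := fun x => by
    rw [hQ, hsqrt, show 2 * k * x / 2 = k * x by ring]
    ring
  have hQpos : ∀ x, 0 < Q x := fun x => by
    have := Real.cosh_pos (k * x)
    rw [hQ]
    positivity
  set T : ℝ → ℝ := fun x => Real.sinh (k * x) / Real.cosh (k * x) with hTdef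
  have hQT : ∀ x, Q x = 6 * k ^ 2 * (1 - T x ^ 2) := fun x => by
    have h := (Real.cosh_pos (k * x)).ne'
    have h2 := Real.cosh_sq (k * x)
    simp only [hQ, hTdef]
    field_simp
    linarith
  have dlin : ∀ x, HasDerivAt (fun x => k * x) k x := fun x => by
    simpa using (hasDerivAt_id x).const_mul k
  have hT : ∀ x, HasDerivAt T (k * (1 - T x ^ 2)) x := fun x => by
    have h := (Real.cosh_pos (k * x)).ne'
    refine ((dlin x).sinh.div (dlin x).cosh h).congr_deriv ?_
    simp only [hTdef]
    field_simp
  have dQ : ∀ x, HasDerivAt Q (-2 * k * T x * Q x) x := fun x => by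
    have h : HasDerivAt Q _ x :=
      ((((hT x).pow 2).const_sub 1).const_mul (6 * k ^ 2)).congr_of_eventuallyEq
        (Filter.Eventually.of_forall hQT)
    refine h.congr_deriv ?_
    rw [hQT]
    push_cast
    ring
  set q : ℝ → ℝ := fun x => Q x ^ ((3 : ℝ) / 2) with hqdef
  have hq : ∀ x, 0 < q x := fun x => Real.rpow_pos_of_pos (hQpos x) _
  have hq' : ∀ x, HasDerivAt q (-3 * k * T x * q x) x := fun x => by
    refine ((dQ x).rpow_const (p := 3 / 2) (Or.inl (hQpos x).ne')).congr_deriv ?_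
    have := (hQpos x).ne'
    rw [Real.rpow_sub_one this]
    simp only [hqdef]
    field_simp
  have hqsq : ∀ x, q x ^ 2 = Q x ^ 3 := fun x => by
    simp only [hqdef]
    rw [← Real.rpow_mul_natCast (hQpos x).le, ← Real.rpow_natCast]
    norm_num
  have hint : Integrable fun x => q x ^ 2 := by
    refine ((integrable_inv_cosh_pow hk.ne' (n := 6) (by norm_num)).const_mul
      ((6 * k ^ 2) ^ 3)).congr (Filter.Eventually.of_forall fun x => ?_)
    simp only [hqsq, hQ]
    ring
  have hIpos : 0 < ∫ x, q x ^ 2 := by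
    refine (integral_pos_iff_support_of_nonneg (fun x => sq_nonneg _) hint).2 ?_
    rw [Function.support_eq_univ fun x => (pow_pos (hq x) 2).ne']
    simp
  obtain ⟨r, hr⟩ := hsupp.isCompact.isBounded.subset_ball 0
  have hwz : ∀ x, r ≤ |x| → w x = 0 := fun x hx => by
    by_contra h
    have := hr (subset_tsupport w h)
    rw [mem_ball_zero_iff, Real.norm_eq_abs] at this
    linarith
  have hlocal : ∀ R ≥ r, ∀ f : ℝ → ℝ, (∀ x, w x = 0 → f x = 0) →
      ∫ x in (-R)..R, f x = ∫ x, f x := fun R hR f hf => by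
    refine intervalIntegral.integral_eq_integral_of_support_subset fun x hx => ?_
    have h : |x| < R := by
      by_contra h
      exact hx (hf x (hwz x (hR.le.trans (not_lt.1 h))))
    exact ⟨(abs_lt.1 h).1, (abs_lt.1 h).2.le⟩
  have hlim := intervalIntegral_tendsto_integral hint Filter.tendsto_neg_atTop_atBot
    Filter.tendsto_id
  have key := le_of_tendsto ((((hlim.inv₀ hIpos.ne').mul_const
      ((∫ x, w x * q x) ^ 2)).const_sub (∫ x, w x ^ 2)).const_mul (5 * k ^ 2))
    (b := ∫ x, w x *
      (-(deriv (deriv w) x) + 9 * k ^ 2 * w x - 12 * k ^ 2 * (1 - T x ^ 2) * w x)) (by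
    filter_upwards [Filter.eventually_ge_atTop r, Filter.eventually_gt_atTop 0] with R hR hR0
    have h := spectral_gap_interval hR0 hT hq hq' (contDiff_infty.1 hw 2)
      (hwz _ (by rwa [abs_neg, abs_of_pos hR0])) (hwz _ (by rwa [abs_of_pos hR0]))
    rw [hlocal R hR _ fun x hx => by simp [hx], hlocal R hR (fun x => w x * q x)
      fun x hx => by simp [hx], hlocal R hR (fun x => w x * _) fun x hx => by simp [hx]] at h
    exact h)
  simp only [hqsq] at key
  refine ge_iff_le.2 (le_of_eq_of_le (by ring) (key.trans_eq ?_))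
  refine integral_congr_ae (Filter.Eventually.of_forall fun x => ?_)
  simp only [hQT]
  ring
end

section
/- Let c > 0, Q_c(x) = (3c/2)·cosh^{-2}(√c·x/2), φ_c(x) = √c·tanh(√c·x/2), and ℒ_c u = −u'' + c·u − 2·Q_c·u. Then for every smooth compactly supported function u : ℝ → ℝ: −∫_ℝ u'(x)·ℒ_c(u·φ_c)(x) dx ≥ (5c/8)·( ∫_ℝ 3·u(x)²·φ_c'(x) dx − (∫_ℝ Q_c(x)³ dx)^{-1}·(∫_ℝ u(x)·Q_c(x)² dx)² ). -/
open MeasureTheory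

open Filter Topology Set

/-- The properties of the kink `φ = s * tanh (s * x / 2)` and the soliton
`Q = 3 / 2 * (s ^ 2 - φ ^ 2)` on which the virial estimate rests. -/
structure IsKinkSoliton (s : ℝ) (φ Q : ℝ → ℝ) : Prop where
  pos : 0 < s
  soliton_eq : ∀ x, Q x = 3 / 2 * (s ^ 2 - φ x ^ 2)
  soliton_pos : ∀ x, 0 < Q x
  hasDerivAt_kink : ∀ x, HasDerivAt φ (Q x / 3) x
  tendsto_atTop : Tendsto φ atTop (𝓝 s)
  tendsto_atBot : Tendsto φ atBot (𝓝 (-s))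

theorem tendsto_tanh_atTop : Tendsto Real.tanh atTop (𝓝 1) := by
  have h : Tendsto (fun x : ℝ => 1 - 2 * (Real.exp (2 * x) + 1)⁻¹) atTop (𝓝 (1 - 2 * 0)) := by
    refine tendsto_const_nhds.sub (Tendsto.const_mul _ (tendsto_inv_atTop_zero.comp ?_))
    exact tendsto_atTop_add_const_right _ _
      (Real.tendsto_exp_atTop.comp (tendsto_id.const_mul_atTop two_pos))
  rw [mul_zero, sub_zero] at h
  refine h.congr fun x => ?_
  have hx := Real.exp_pos x
  rw [Real.tanh_eq_sinh_div_cosh, Real.sinh_eq, Real.cosh_eq, Real.exp_neg,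
    two_mul x, Real.exp_add]
  field_simp
  ring

theorem tendsto_tanh_atBot : Tendsto Real.tanh atBot (𝓝 (-1)) := by
  have h := (tendsto_tanh_atTop.comp tendsto_neg_atBot_atTop).neg
  refine h.congr fun x => ?_
  simp [Real.tanh_neg]

theorem isKinkSoliton_tanh {c : ℝ} (hc : 0 < c) {Q φ : ℝ → ℝ}
    (hQ : ∀ x, Q x = (3 * c / 2) * (Real.cosh (Real.sqrt c * x / 2))⁻¹ ^ 2)
    (hφ : ∀ x, φ x = Real.sqrt c * Real.tanh (Real.sqrt c * x / 2)) :
    IsKinkSoliton (Real.sqrt c) φ Q := by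
  have hs : 0 < Real.sqrt c := Real.sqrt_pos.2 hc
  have hsq : Real.sqrt c ^ 2 = c := Real.sq_sqrt hc.le
  have hφ' : φ = fun x => Real.sqrt c * Real.tanh (Real.sqrt c * x / 2) := funext hφ
  refine ⟨hs, fun x => ?_, fun x => ?_, fun x => ?_, ?_, ?_⟩
  · have h1 := Real.cosh_pos (Real.sqrt c * x / 2)
    have h2 := Real.cosh_sq (Real.sqrt c * x / 2)
    rw [hQ, hφ, Real.tanh_eq_sinh_div_cosh, mul_pow, hsq]
    field_simp
    rw [h2]
    ring
  · have h1 := Real.cosh_pos (Real.sqrt c * x / 2)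
    rw [hQ]
    positivity
  · have h1 := Real.cosh_pos (Real.sqrt c * x / 2)
    have h2 := Real.cosh_sq (Real.sqrt c * x / 2)
    have hl : HasDerivAt (fun x => Real.sqrt c * x / 2) (Real.sqrt c / 2) x := by
      simpa using ((hasDerivAt_id x).const_mul (Real.sqrt c)).div_const 2
    have h := (hl.sinh.div hl.cosh h1.ne').const_mul (Real.sqrt c)
    have hf : φ = fun y => Real.sqrt c *
        ((fun x => Real.sinh (Real.sqrt c * x / 2)) / fun x => Real.cosh (Real.sqrt c * x / 2)) y := by
      funext y
      simp [hφ, Real.tanh_eq_sinh_div_cosh]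
    rw [hf]
    refine h.congr_deriv ?_
    rw [hQ]
    field_simp
    rw [hsq]
    linear_combination c * h2
  · have hl : Tendsto (fun x => Real.sqrt c * x / 2) atTop atTop :=
      (tendsto_id.const_mul_atTop hs).atTop_div_const two_pos
    simpa [hφ', Function.comp_def] using (tendsto_tanh_atTop.comp hl).const_mul (Real.sqrt c)
  · have hl : Tendsto (fun x => Real.sqrt c * x / 2) atBot atBot :=
      (tendsto_id.const_mul_atBot hs).atBot_div_const two_pos
    simpa [hφ', Function.comp_def] using (tendsto_tanh_atBot.comp hl).const_mul (Real.sqrt c)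

namespace IsKinkSoliton

variable {s : ℝ} {φ Q : ℝ → ℝ}

theorem hasDerivAt_soliton (h : IsKinkSoliton s φ Q) (x : ℝ) :
    HasDerivAt Q (-(φ x * Q x)) x := by
  have h1 := (((h.hasDerivAt_kink x).pow 2).const_sub (s ^ 2)).const_mul (3 / 2)
  have hf : Q = fun x => 3 / 2 * (s ^ 2 - (φ ^ 2) x) := funext fun x => by simp [h.soliton_eq]
  rw [hf]
  refine (h1.congr_deriv ?_)
  simp only [Pi.pow_apply, ← h.soliton_eq]
  push_cast
  ring

theorem continuous_kink (h : IsKinkSoliton s φ Q) : Continuous φ :=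
  continuous_iff_continuousAt.2 fun x => (h.hasDerivAt_kink x).continuousAt

theorem continuous_soliton (h : IsKinkSoliton s φ Q) : Continuous Q :=
  continuous_iff_continuousAt.2 fun x => (h.hasDerivAt_soliton x).continuousAt

/-- An explicit primitive of `Q ^ 3`. -/
theorem hasDerivAt_cubePrimitive (h : IsKinkSoliton s φ Q) (x : ℝ) :
    HasDerivAt (fun x => 27 / 4 * (s ^ 4 * φ x - 2 * s ^ 2 / 3 * φ x ^ 3 + φ x ^ 5 / 5))
      (Q x ^ 3) x := by
  have hd := h.hasDerivAt_kink x
  have h1 := ((((hd.const_mul (s ^ 4)).sub ((hd.fun_pow 3).const_mul (2 * s ^ 2 / 3))).add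
    ((hd.fun_pow 5).div_const 5))).const_mul (27 / 4)
  refine h1.congr_deriv ?_
  rw [h.soliton_eq]
  push_cast
  ring

theorem tendsto_cubePrimitive {l : Filter ℝ} {a : ℝ} (hl : Tendsto φ l (𝓝 a)) :
    Tendsto (fun x => 27 / 4 * (s ^ 4 * φ x - 2 * s ^ 2 / 3 * φ x ^ 3 + φ x ^ 5 / 5)) l
      (𝓝 (27 / 4 * (s ^ 4 * a - 2 * s ^ 2 / 3 * a ^ 3 + a ^ 5 / 5))) :=
  ((((hl.const_mul _).sub ((hl.pow 3).const_mul _)).add ((hl.pow 5).div_const 5))).const_mul _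

theorem integrable_cube (h : IsKinkSoliton s φ Q) : Integrable fun x => Q x ^ 3 := by
  have hcont : Continuous fun x => Q x ^ 3 := h.continuous_soliton.pow 3
  have hlim := (tendsto_cubePrimitive (s := s) h.tendsto_atTop).sub
    ((tendsto_cubePrimitive (s := s) h.tendsto_atBot).comp tendsto_neg_atTop_atBot)
  refine integrable_of_intervalIntegral_norm_tendsto (l := atTop) (a := fun x : ℝ => -x)
    (b := fun x => x) _ (fun x => ?_) tendsto_neg_atTop_atBot tendsto_id (hlim.congr fun x => ?_)
  · exact (hcont.integrableOn_Icc).mono_set Ioc_subset_Icc_self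
  · have hn : ∀ y, ‖Q y ^ 3‖ = Q y ^ 3 := fun y =>
      Real.norm_of_nonneg (pow_nonneg (h.soliton_pos y).le 3)
    simp only [hn]
    rw [intervalIntegral.integral_eq_sub_of_hasDerivAt
      (fun y _ => h.hasDerivAt_cubePrimitive y) (hcont.intervalIntegrable _ _)]
    rfl

theorem integral_cube (h : IsKinkSoliton s φ Q) : ∫ x, Q x ^ 3 = 36 / 5 * s ^ 5 := by
  rw [integral_of_hasDerivAt_of_tendsto h.hasDerivAt_cubePrimitive h.integrable_cube
    (tendsto_cubePrimitive h.tendsto_atBot) (tendsto_cubePrimitive h.tendsto_atTop)]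
  ring

end IsKinkSoliton

/-- If `f` dominates the derivative of a function vanishing at `±∞`, then `∫ f ≥ 0`. -/
theorem integral_nonneg_of_hasDerivAt_le {f g g' : ℝ → ℝ} (hf : Integrable f)
    (hg : ∀ x, HasDerivAt g (g' x) x) (hle : ∀ x, g' x ≤ f x)
    (hbot : Tendsto g atBot (𝓝 0)) (htop : Tendsto g atTop (𝓝 0)) : 0 ≤ ∫ x, f x := by
  have h1 := intervalIntegral_tendsto_integral hf tendsto_neg_atTop_atBot tendsto_id
  have h2 := htop.sub (hbot.comp tendsto_neg_atTop_atBot)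
  rw [sub_zero] at h2
  refine le_of_tendsto_of_tendsto h2 h1 ?_
  filter_upwards [eventually_ge_atTop (0 : ℝ)] with x hx
  exact intervalIntegral.sub_le_integral_of_hasDeriv_right_of_le (by simp; linarith)
    (fun y _ => (hg y).continuousAt.continuousWithinAt) (fun y _ => (hg y).hasDerivWithinAt)
    hf.integrableOn (fun y _ => hle y)

namespace IsKinkSoliton

variable {s : ℝ} {φ Q : ℝ → ℝ}

/-- The boundary term of the spectral gap estimate; `p` is the function and `m` a primitive
of `p * Q ^ 2`. -/
theorem tendsto_boundary_zero (h : IsKinkSoliton s φ Q) {l : Filter ℝ} {σ β : ℝ}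
    (hσ : σ ^ 2 = 1) (hl : Tendsto φ l (𝓝 (σ * s))) {p m : ℝ → ℝ}
    (hp : ∀ᶠ x in l, p x = -(β * Q x))
    (hm : ∀ᶠ x in l, m x = β * (27 / 4 * (8 / 15 * σ * s ^ 5
      - (s ^ 4 * φ x - 2 * s ^ 2 / 3 * φ x ^ 3 + φ x ^ 5 / 5)))) :
    Tendsto (fun x => -(5 * s ^ 2 / 4) * (m x * p x / Q x)
      - 25 * s ^ 2 / 16 * φ x * (m x ^ 2 / Q x ^ 3)) l (𝓝 0) := by
  have hs := h.pos
  let ψ : ℝ → ℝ := fun r => 5 * s ^ 2 / 4 * β ^ 2 * (27 / 60 * (σ * s - r) ^ 3 *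
      (8 * s ^ 2 + 9 * σ * s * r + 3 * r ^ 2))
    - 25 * s ^ 2 / 16 * r * (β ^ 2 * (3 / 50) * (σ * s - r) ^ 3
      * (8 * s ^ 2 + 9 * σ * s * r + 3 * r ^ 2) ^ 2 / (σ * s + r) ^ 3)
  have hσs : σ * s + σ * s ≠ 0 := by
    have : σ ≠ 0 := by rintro rfl; norm_num at hσ
    rw [← two_mul]
    positivity
  have hψ : ContinuousAt ψ (σ * s) := by
    have : (σ * s + σ * s) ^ 3 ≠ 0 := pow_ne_zero _ hσs
    fun_prop (disch := assumption)
  have hψ0 : ψ (σ * s) = 0 := by simp [ψ]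
  have hlim := hψ.tendsto.comp hl
  rw [hψ0] at hlim
  refine hlim.congr' ?_
  filter_upwards [hp, hm] with x hpx hmx
  have hQ := h.soliton_pos x
  have hQe : Q x = 3 / 2 * ((σ * s - φ x) * (σ * s + φ x)) := by
    rw [h.soliton_eq]
    linear_combination -(3 / 2 * s ^ 2) * hσ
  have hprod : (σ * s - φ x) * (σ * s + φ x) ≠ 0 := by
    intro h0
    rw [hQe, h0] at hQ
    simp at hQ
  obtain ⟨hd1, hd2⟩ := mul_ne_zero_iff.1 hprod
  have hm' : m x = β * (27 / 60 * (σ * s - φ x) ^ 3 *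
      (8 * s ^ 2 + 9 * σ * s * φ x + 3 * φ x ^ 2)) := by
    rw [hmx]
    rcases sq_eq_sq_iff_eq_or_eq_neg.1 (hσ.trans (one_pow 2).symm) with rfl | rfl <;> ring
  simp only [Function.comp_apply, ψ]
  have hfirst : m x * p x / Q x = -(β * m x) := by
    rw [hpx]
    field_simp
  have hsecond : m x ^ 2 / Q x ^ 3 = β ^ 2 * (3 / 50) * (σ * s - φ x) ^ 3
      * (8 * s ^ 2 + 9 * σ * s * φ x + 3 * φ x ^ 2) ^ 2 / (σ * s + φ x) ^ 3 := by
    rw [hm', hQe, div_eq_div_iff (by positivity) (pow_ne_zero _ hd2)]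
    ring
  rw [hfirst, hsecond, hm']
  ring

/-- The second eigenvalue bound for the Pöschl–Teller operator attached to `Q`, in the form
obtained after the ground state substitution. -/
theorem spectral_gap (h : IsKinkSoliton s φ Q) {u u' : ℝ → ℝ}
    (hu : ∀ x, HasDerivAt u (u' x) x) (hu' : Continuous u') (hsupp : HasCompactSupport u)
    (hsupp' : HasCompactSupport u') :
    5 * s ^ 2 / 8 * ((∫ x, u x ^ 2 * Q x) - (∫ x, Q x ^ 3)⁻¹ * (∫ x, u x * Q x ^ 2) ^ 2)
      ≤ ∫ x, Q x / 2 * (u' x + φ x * u x) ^ 2 := by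
  have hs := h.pos
  have hQc := h.continuous_soliton
  have hφc := h.continuous_kink
  have huc : Continuous u := continuous_iff_continuousAt.2 fun x => (hu x).continuousAt
  obtain ⟨R, hR⟩ : ∃ R, ∀ x, R ≤ |x| → u x = 0 := by
    obtain ⟨R, hR⟩ := hsupp.isCompact.isBounded.subset_ball 0
    refine ⟨R, fun x hx => image_eq_zero_of_notMem_tsupport fun hmem => ?_⟩
    have := hR hmem
    rw [mem_ball_zero_iff, Real.norm_eq_abs] at this
    linarith
  set I := ∫ x, u x * Q x ^ 2 with hI
  set N := ∫ x, Q x ^ 3 with hN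
  have hNe : N = 36 / 5 * s ^ 5 := h.integral_cube
  have hNpos : 0 < N := by rw [hNe]; positivity
  set β := N⁻¹ * I with hβ
  have hβN : β * N = I := by rw [hβ]; field_simp
  have hcuQ : Continuous fun x => u x * Q x ^ 2 := by fun_prop
  let P : ℝ → ℝ := fun x => 27 / 4 * (s ^ 4 * φ x - 2 * s ^ 2 / 3 * φ x ^ 3 + φ x ^ 5 / 5)
  let J : ℝ → ℝ := fun x => ∫ y in (-R)..x, u y * Q y ^ 2
  let p : ℝ → ℝ := fun x => u x - β * Q x
  let m : ℝ → ℝ := fun x => J x - β * (P x + 18 / 5 * s ^ 5)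
  have hJ : ∀ x, HasDerivAt J (u x * Q x ^ 2) x := fun x =>
    intervalIntegral.integral_hasDerivAt_right (hcuQ.intervalIntegrable _ _)
      (hcuQ.stronglyMeasurableAtFilter _ _) hcuQ.continuousAt
  have hm : ∀ x, HasDerivAt m (p x * Q x ^ 2) x := fun x => by
    refine ((hJ x).sub (((h.hasDerivAt_cubePrimitive x).add_const _).const_mul β)).congr_deriv ?_
    simp only [p]
    ring
  have hp : ∀ x, HasDerivAt p (u' x + β * (φ x * Q x)) x := fun x => by
    refine ((hu x).sub ((h.hasDerivAt_soliton x).const_mul β)).congr_deriv ?_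
    ring
  have hJbot : ∀ x ≤ -|R|, J x = 0 := fun x hx => by
    refine intervalIntegral.integral_zero_ae (ae_of_all _ fun y hy => ?_)
    have hxR : x ≤ -R := hx.trans (neg_le_neg (le_abs_self R))
    rw [uIoc_of_ge hxR] at hy
    rw [hR y, zero_mul]
    linarith [hy.2, neg_le_abs y]
  have hJtop : ∀ x, |R| ≤ x → J x = I := fun x hx => by
    refine intervalIntegral.integral_eq_integral_of_support_subset fun y hy => ?_
    have hy' : |y| < R := by
      by_contra hlt
      exact hy (by simp [hR y (not_lt.1 hlt)])
    rw [abs_lt] at hy'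
    exact ⟨hy'.1, by linarith [hy'.2, le_abs_self R]⟩
  have hptail : ∀ x, R ≤ |x| → p x = -(β * Q x) := fun x hx => by simp [p, hR x hx]
  have hbot := h.tendsto_boundary_zero (σ := -1) (β := β) (p := p) (m := m) (by norm_num)
    (by simpa using h.tendsto_atBot)
    (by
      filter_upwards [eventually_le_atBot (-|R|)] with x hx
      exact hptail x (by linarith [neg_le_abs x, le_abs_self R]))
    (by
      filter_upwards [eventually_le_atBot (-|R|)] with x hx
      simp only [m, P, hJbot x hx]
      ring)
  have htop := h.tendsto_boundary_zero (σ := 1) (β := β) (p := p) (m := m) (by norm_num)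
    (by simpa using h.tendsto_atTop)
    (by
      filter_upwards [eventually_ge_atTop |R|] with x hx
      exact hptail x (by linarith [le_abs_self x, le_abs_self R]))
    (by
      filter_upwards [eventually_ge_atTop |R|] with x hx
      simp only [m, P, hJtop x hx, ← hβN, hNe]
      ring)
  have hderiv : ∀ x, HasDerivAt (fun x => -(5 * s ^ 2 / 4) * (m x * p x / Q x)
      - 25 * s ^ 2 / 16 * φ x * (m x ^ 2 / Q x ^ 3))
      (Q x / 2 * (u' x + φ x * u x) ^ 2 - 5 * s ^ 2 / 8 * (Q x * p x ^ 2)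
        - (Q x / 2 * (u' x + φ x * u x + 5 * s ^ 2 / 4 * (m x / Q x ^ 2)) ^ 2
          + 5 * s ^ 2 / 8 * Q x * (p x + 5 / 2 * φ x * (m x / Q x ^ 2)) ^ 2)) x := fun x => by
    have hQ := (h.soliton_pos x).ne'
    have hQd := h.hasDerivAt_soliton x
    have h1 := ((((hm x).fun_mul (hp x)).fun_div hQd hQ).const_mul (-(5 * s ^ 2 / 4))).fun_sub
      (((h.hasDerivAt_kink x).const_mul (25 * s ^ 2 / 16)).fun_mul
        (((hm x).fun_pow 2).fun_div (hQd.fun_pow 3) (pow_ne_zero 3 hQ)))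
    refine h1.congr_deriv ?_
    have hu_eq : u x = p x + β * Q x := by simp [p]
    have hs2 : s ^ 2 = 2 / 3 * Q x + φ x ^ 2 := by rw [h.soliton_eq]; ring
    rw [hu_eq, hs2]
    push_cast
    field_simp
    ring
  have hint1 : Integrable fun x => Q x / 2 * (u' x + φ x * u x) ^ 2 := by
    refine Continuous.integrable_of_hasCompactSupport (by fun_prop) ?_
    have hsum : HasCompactSupport fun x => u' x + φ x * u x := hsupp'.add hsupp.mul_left
    simp only [pow_two, ← mul_assoc]
    exact hsum.mul_left
  have hint2 : Integrable fun x => u x ^ 2 * Q x :=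
    Continuous.integrable_of_hasCompactSupport (by fun_prop) <| by
      simp only [pow_two, mul_assoc]
      exact hsupp.mul_right
  have hint3 : Integrable fun x => u x * Q x ^ 2 :=
    hcuQ.integrable_of_hasCompactSupport hsupp.mul_right
  have hint4 := h.integrable_cube
  have hQp : ∀ x, Q x * p x ^ 2 = u x ^ 2 * Q x - 2 * β * (u x * Q x ^ 2) + β ^ 2 * Q x ^ 3 :=
    fun x => by simp only [p]; ring
  have hint23 : Integrable fun x => u x ^ 2 * Q x - 2 * β * (u x * Q x ^ 2) :=
    hint2.sub (hint3.const_mul (2 * β))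
  have hint5 : Integrable fun x => Q x * p x ^ 2 := by
    simp only [hQp]
    exact hint23.add (hint4.const_mul _)
  have hval : ∫ x, Q x * p x ^ 2 = (∫ x, u x ^ 2 * Q x) - N⁻¹ * I ^ 2 := by
    simp only [hQp]
    rw [integral_add hint23 (hint4.const_mul _), integral_sub hint2 (hint3.const_mul _),
      integral_const_mul, integral_const_mul, ← hI, ← hN, hβ]
    field_simp
    ring
  have key := integral_nonneg_of_hasDerivAt_le (hint1.sub (hint5.const_mul (5 * s ^ 2 / 8)))
    hderiv (fun x => by
      have hQ := h.soliton_pos x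
      simp only [Pi.sub_apply]
      refine sub_le_self _ ?_
      positivity) hbot htop
  simp only [Pi.sub_apply] at key
  rw [integral_sub hint1 (hint5.const_mul _), integral_const_mul, hval] at key
  linarith

/-- Integration by parts in the virial functional. -/
theorem virial_identity (h : IsKinkSoliton s φ Q) {u u' u'' : ℝ → ℝ}
    (hu : ∀ x, HasDerivAt u (u' x) x) (hu' : ∀ x, HasDerivAt u' (u'' x) x)
    (hu'' : Continuous u'') (hsupp : HasCompactSupport u) (hsupp' : HasCompactSupport u') :
    -∫ x, u' x * (-(u'' x * φ x + 2 / 3 * u' x * Q x - 1 / 3 * u x * (φ x * Q x))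
        + s ^ 2 * (u x * φ x) - 2 * Q x * (u x * φ x))
      = ∫ x, Q x / 2 * (u' x + φ x * u x) ^ 2 := by
  have hQc := h.continuous_soliton
  have hφc := h.continuous_kink
  have huc : Continuous u := continuous_iff_continuousAt.2 fun x => (hu x).continuousAt
  have huc' : Continuous u' := continuous_iff_continuousAt.2 fun x => (hu' x).continuousAt
  have hint1 : Integrable fun x => Q x / 2 * (u' x + φ x * u x) ^ 2 := by
    refine Continuous.integrable_of_hasCompactSupport (by fun_prop) ?_
    have hsum : HasCompactSupport fun x => u' x + φ x * u x := hsupp'.add hsupp.mul_left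
    simp only [pow_two, ← mul_assoc]
    exact hsum.mul_left
  have hint2 : Integrable fun x => u' x * (-(u'' x * φ x + 2 / 3 * u' x * Q x
      - 1 / 3 * u x * (φ x * Q x)) + s ^ 2 * (u x * φ x) - 2 * Q x * (u x * φ x)) :=
    Continuous.integrable_of_hasCompactSupport (by fun_prop) hsupp'.mul_right
  have hG : ∀ x, HasDerivAt (fun x => u' x * (u' x * (φ x / 2))
      + u x * (u x * (φ x * (Q x / 3 - s ^ 2 / 2))))
      (-(Q x / 2 * (u' x + φ x * u x) ^ 2 + u' x * (-(u'' x * φ x + 2 / 3 * u' x * Q x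
      - 1 / 3 * u x * (φ x * Q x)) + s ^ 2 * (u x * φ x) - 2 * Q x * (u x * φ x)))) x := fun x => by
    have hφd := h.hasDerivAt_kink x
    have h1 := ((hu' x).fun_mul ((hu' x).fun_mul (hφd.div_const 2))).fun_add
      ((hu x).fun_mul ((hu x).fun_mul (hφd.fun_mul
        (((h.hasDerivAt_soliton x).div_const 3).sub_const (s ^ 2 / 2)))))
    refine h1.congr_deriv ?_
    have hs2 : s ^ 2 = 2 / 3 * Q x + φ x ^ 2 := by rw [h.soliton_eq]; ring
    rw [hs2]
    ring
  have hGint : Integrable (fun x => u' x * (u' x * (φ x / 2))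
      + u x * (u x * (φ x * (Q x / 3 - s ^ 2 / 2)))) :=
    Continuous.integrable_of_hasCompactSupport (by fun_prop) (hsupp'.mul_right.add hsupp.mul_right)
  have hzero := integral_eq_zero_of_hasDerivAt_of_integrable hG (hint1.add hint2).neg hGint
  rw [integral_neg, integral_add hint1 hint2] at hzero
  linarith

end IsKinkSoliton

theorem virial_coercivity_estimate
    (c : ℝ) (hc : 0 < c) (Q φ : ℝ → ℝ)
    (hQ : ∀ x, Q x = (3 * c / 2) * (Real.cosh (Real.sqrt c * x / 2))⁻¹ ^ 2)
    (hφ : ∀ x, φ x = Real.sqrt c * Real.tanh (Real.sqrt c * x / 2)) :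
    ∀ u : ℝ → ℝ, ContDiff ℝ (⊤ : ℕ∞) u → HasCompactSupport u →
      -∫ x : ℝ, deriv u x *
          (-(deriv (deriv (fun y => u y * φ y)) x)
            + c * (u x * φ x) - 2 * Q x * (u x * φ x))
        ≥ (5 * c / 8) *
            ((∫ x : ℝ, 3 * (u x) ^ 2 * deriv φ x)
              - (∫ x : ℝ, (Q x) ^ 3)⁻¹ *
                  (∫ x : ℝ, u x * (Q x) ^ 2) ^ 2) := by
  intro u hu hsupp
  have h := isKinkSoliton_tanh hc hQ hφ
  have hd : ∀ x, HasDerivAt u (deriv u x) x := fun x =>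
    (hu.differentiable (by simp) x).hasDerivAt
  have hu1 : ContDiff ℝ (⊤ : ℕ∞) (deriv u) := (contDiff_infty_iff_deriv.1 hu).2
  have hd' : ∀ x, HasDerivAt (deriv u) (deriv (deriv u) x) x := fun x =>
    (hu1.differentiable (by simp) x).hasDerivAt
  have hderiv1 : deriv (fun y => u y * φ y) = fun x => deriv u x * φ x + u x * (Q x / 3) :=
    funext fun x => ((hd x).fun_mul (h.hasDerivAt_kink x)).deriv
  have hderiv2 : deriv (deriv fun y => u y * φ y) = fun x => deriv (deriv u) x * φ x
      + 2 / 3 * deriv u x * Q x - 1 / 3 * u x * (φ x * Q x) := funext fun x => by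
    rw [hderiv1, (((hd' x).fun_mul (h.hasDerivAt_kink x)).fun_add
      ((hd x).fun_mul ((h.hasDerivAt_soliton x).div_const 3))).deriv]
    ring
  have hkink : ∀ x, 3 * u x ^ 2 * deriv φ x = u x ^ 2 * Q x := fun x => by
    rw [(h.hasDerivAt_kink x).deriv]
    ring
  have hid := h.virial_identity hd hd' (hu1.continuous_deriv (by simp)) hsupp hsupp.deriv
  have hgap := h.spectral_gap hd hu1.continuous hsupp hsupp.deriv
  rw [Real.sq_sqrt hc.le] at hid hgap
  simp only [hderiv2, hkink]
  rw [ge_iff_le, hid]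
  exact hgap
end
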